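/- arXiv:1606.02681 — 12 statements merged into one kernel-verified Lean document; each statement's English description precedes it below -/
import Mathlib

section
/- Let F be a field, m ≥ 1, I = {1,…,m}, and let a, b : I × I → I be associative binary operations. Suppose there is a permutation π of I with a(j,n) = π⁻¹(b(π(j), π(n))) for all j,n ∈ I. Then the linear map f on cubic matrices defined by f(X)(i,j,k) = X(π⁻¹(i), π⁻¹(j), π⁻¹(k)) is a bijective linear map satisfying f(X *_a Y) = f(X) *_b f(Y) for all cubic matrices X, Y; hence the algebras 𝔠_a and 𝔠_b are isomorphic. -/
open Finset

/-- The set of `m × m × m` cubic matrices over `F`. -/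
abbrev CubicMatrix (m : ℕ) (F : Type*) := Fin m → Fin m → Fin m → F

/-- Maksimov multiplication of cubic matrices associated to a binary operation `a`:
`(A *_a B) i j r = ∑_{(l,n) : a l n = j} ∑_k A i l k * B k n r`. -/
def cubicMul {m : ℕ} {F : Type*} [Field F] (a : Fin m → Fin m → Fin m)
    (A B : CubicMatrix m F) : CubicMatrix m F :=
  fun i j r => ∑ l, ∑ n, if a l n = j then ∑ k, A i l k * B k n r else 0

/-- The basis cubic matrix `E i j k` whose `(i,j,k)` entry is `1` and all others `0`. -/
def cubicE {m : ℕ} (F : Type*) [Field F] (i j k : Fin m) : CubicMatrix m F :=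
  fun i2 j2 k2 => if i2 = i ∧ j2 = j ∧ k2 = k then 1 else 0


/-- If `a` and `b` are equivalent associative operations, i.e. `a(j,n) = π⁻¹(b(π j, π n))`
for some permutation `π`, then the map `f(X)(i,j,k) = X(π⁻¹ i, π⁻¹ j, π⁻¹ k)` is a bijective
linear map with `f(X *_a Y) = f X *_b f Y`; hence `𝔠_a ≅ 𝔠_b`. -/
theorem equivalent_ops_isomorphic_ACM {m : ℕ} (hm : 1 ≤ m) {F : Type*} [Field F]
    (a b : Fin m → Fin m → Fin m)
    (ha : ∀ i j k, a (a i j) k = a i (a j k))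
    (hb : ∀ i j k, b (b i j) k = b i (b j k))
    (π : Equiv.Perm (Fin m))
    (hab : ∀ j n, a j n = π.symm (b (π j) (π n))) :
    let f : CubicMatrix m F → CubicMatrix m F :=
      fun X i j k => X (π.symm i) (π.symm j) (π.symm k)
    Function.Bijective f ∧
    (∀ X Y : CubicMatrix m F, f (X + Y) = f X + f Y) ∧
    (∀ (c : F) (X : CubicMatrix m F), f (c • X) = c • f X) ∧
    (∀ X Y : CubicMatrix m F, f (cubicMul a X Y) = cubicMul b (f X) (f Y)) := by
  intro f
  refine ⟨⟨fun X Y h => ?_, fun Y => ⟨fun i j k => Y (π i) (π j) (π k), ?_⟩⟩,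
    fun _ _ => rfl, fun _ _ => rfl, fun X Y => ?_⟩
  · funext i j k
    simpa [f] using congrFun (congrFun (congrFun h (π i)) (π j)) (π k)
  · funext i j k
    simp [f]
  · funext i j r
    simp only [f, cubicMul]
    refine Fintype.sum_equiv π _ _ fun l => Fintype.sum_equiv π _ _ fun n => ?_
    simp only [hab, Equiv.symm_apply_apply, EmbeddingLike.apply_eq_iff_eq]
    exact if_congr Iff.rfl (Fintype.sum_equiv π _ _ fun k => by simp) rfl
end

section
/- Let I = {1,…,m} and let a : I × I → I be an associative binary operation. Then a is symmetric, i.e., a(j,n) = π(a(π⁻¹(j), π⁻¹(n))) for all j,n ∈ I and all permutations π of I, if and only if either a(i,j) = j for all i,j ∈ I (right-symmetric) or a(i,j) = i for all i,j ∈ I (left-symmetric). -/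
section EquivariantOperations

variable {α : Type*} {a : α → α → α}

/-- An associative operation that commutes with all permutations is idempotent. -/
theorem self_of_assoc_of_equivariant [DecidableEq α]
    (ha : ∀ i j k, a (a i j) k = a i (a j k))
    (h : ∀ (π : Equiv.Perm α) (i j : α), π (a i j) = a (π i) (π j)) (i : α) : a i i = i := by
  by_contra hc
  have hcomm : a (a i i) i = a i (a i i) := ha i i i
  generalize hci : a i i = c at hc hcomm
  have hswap := h (Equiv.swap i c) i c
  rw [Equiv.swap_apply_left, Equiv.swap_apply_right, hcomm] at hswap
  generalize a i c = d at hswap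
  have hdi : d ≠ i := by
    rintro rfl
    exact hc (by simpa using hswap)
  have hdc : d ≠ c := by
    rintro rfl
    exact hc (by simpa using hswap.symm)
  have hfix := h (Equiv.swap c d) i i
  rw [Equiv.swap_apply_of_ne_of_ne (Ne.symm hc) hdi.symm, hci, Equiv.swap_apply_left] at hfix
  exact hdc hfix

/-- An associative operation that commutes with all permutations returns one of its arguments. -/
theorem eq_left_or_right_of_assoc_of_equivariant [DecidableEq α]
    (ha : ∀ i j k, a (a i j) k = a i (a j k))
    (h : ∀ (π : Equiv.Perm α) (i j : α), π (a i j) = a (π i) (π j)) (i j : α) :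
    a i j = i ∨ a i j = j := by
  by_contra! hne
  obtain ⟨hki, hkj⟩ := hne
  have hij : i ≠ j := by
    rintro rfl
    exact hki (self_of_assoc_of_equivariant ha h i)
  have habs : a i (a i j) = a i j := by
    rw [← ha, self_of_assoc_of_equivariant ha h]
  have hswap := h (Equiv.swap j (a i j)) i j
  rw [Equiv.swap_apply_right, Equiv.swap_apply_of_ne_of_ne hij hki.symm,
    Equiv.swap_apply_left, habs] at hswap
  exact hkj hswap.symm

/-- An operation that commutes with all permutations and is a left projection on one pair of
distinct elements is a left projection on all such pairs. -/
theorem eq_left_of_equivariant [DecidableEq α]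
    (h : ∀ (π : Equiv.Perm α) (i j : α), π (a i j) = a (π i) (π j)) {i j k l : α}
    (hij : i ≠ j) (hkl : k ≠ l) (haij : a i j = i) : a k l = k := by
  have hk : k ≠ Equiv.swap i k j := fun hk => hij <| (Equiv.swap i k).injective <| by
    rw [Equiv.swap_apply_left, ← hk]
  have hπ := h (Equiv.swap (Equiv.swap i k j) l * Equiv.swap i k) i j
  rw [haij] at hπ
  simp only [Equiv.Perm.mul_apply, Equiv.swap_apply_left,
    Equiv.swap_apply_of_ne_of_ne hk hkl] at hπ
  exact hπ.symm

end EquivariantOperations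

/-- An associative binary operation `a` on `I = {1,…,m}` is symmetric (fixed by the action of
every permutation) iff it is right-symmetric (`a i j = j`) or left-symmetric (`a i j = i`). -/
theorem symmetric_iff_rs_or_ls {m : ℕ} (hm : 1 ≤ m) (a : Fin m → Fin m → Fin m)
    (ha : ∀ i j k, a (a i j) k = a i (a j k)) :
    (∀ (π : Equiv.Perm (Fin m)) (j n : Fin m), a j n = π (a (π.symm j) (π.symm n))) ↔
      ((∀ i j : Fin m, a i j = j) ∨ (∀ i j : Fin m, a i j = i)) := by
  constructor
  · intro hsymm
    have h : ∀ (π : Equiv.Perm (Fin m)) (i j : Fin m), π (a i j) = a (π i) (π j) := by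
      intro π i j
      simpa using (hsymm π (π i) (π j)).symm
    refine or_iff_not_imp_left.mpr fun hr k l => ?_
    push Not at hr
    obtain ⟨i, j, haj⟩ := hr
    have hai : a i j = i := (eq_left_or_right_of_assoc_of_equivariant ha h i j).resolve_right haj
    obtain rfl | hkl := eq_or_ne k l
    · exact self_of_assoc_of_equivariant ha h k
    · exact eq_left_of_equivariant h (fun hij => haj (hai.trans hij)) hkl hai
  · rintro (h | h) π j n <;> simp [h]
end

section
/- For every m ≥ 2 and every associative binary operation a : I × I → I, the algebra 𝔠_a of m×m×m cubic matrices over ℝ is not baric: every ℝ-linear map χ : 𝔠_a → ℝ satisfying χ(X *_a Y) = χ(X)·χ(Y) for all X, Y ∈ 𝔠_a is identically zero. -/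
open Finset

/-- Basis cubic matrices with matching inner indices multiply like matrix units. -/
theorem cubicMul_cubicE {m : ℕ} {F : Type*} [Field F] (a : Fin m → Fin m → Fin m)
    (i l k n r : Fin m) :
    cubicMul a (cubicE F i l k) (cubicE F k n r) = cubicE F i (a l n) r := by
  funext x y z
  simp only [cubicMul, cubicE]
  rw [Finset.sum_eq_single l, Finset.sum_eq_single n, Finset.sum_eq_single k]
  · by_cases hx : x = i <;> by_cases hz : z = r <;> simp [hx, hz, eq_comm]
  · intro b _ hb
    simp [hb]
  · simp
  · intro b _ hb
    simp [hb]
  · simp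
  · intro b _ hb
    simp [hb]
  · simp

/-- Basis cubic matrices with distinct inner indices have product zero. -/
theorem cubicMul_cubicE_of_ne {m : ℕ} {F : Type*} [Field F] (a : Fin m → Fin m → Fin m)
    {k k' : Fin m} (h : k ≠ k') (i l n r : Fin m) :
    cubicMul a (cubicE F i l k) (cubicE F k' n r) = 0 := by
  funext x y z
  simp only [cubicMul, cubicE, Pi.zero_apply]
  refine Finset.sum_eq_zero fun b _ => Finset.sum_eq_zero fun c _ => ?_
  rw [Finset.sum_eq_zero, ite_self]
  intro d _
  by_cases hd : d = k
  · subst hd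
    simp [h]
  · simp [hd]

theorem cubicE_eq_single {m : ℕ} {F : Type*} [Field F] (i j k : Fin m) :
    cubicE F i j k = Pi.single i (Pi.single j (Pi.single k 1)) := by
  funext x y z
  by_cases hx : x = i
  · subst hx
    by_cases hy : y = j
    · subst hy
      simp [cubicE, Pi.single_apply]
    · simp [cubicE, hy]
  · simp [cubicE, hx]

/-- For `m ≥ 2` the algebra `𝔠_a` of cubic matrices over `ℝ` is not baric: every ℝ-linear
multiplicative map `χ : 𝔠_a → ℝ` is identically zero. -/
theorem ACM_not_baric {m : ℕ} (hm : 2 ≤ m) (a : Fin m → Fin m → Fin m)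
    (ha : ∀ i j k, a (a i j) k = a i (a j k))
    (χ : CubicMatrix m ℝ →ₗ[ℝ] ℝ)
    (hχ : ∀ X Y : CubicMatrix m ℝ, χ (cubicMul a X Y) = χ X * χ Y) :
    χ = 0 := by
  have h_off : ∀ i l k, i ≠ k → χ (cubicE ℝ i l k) = 0 := by
    intro i l k h
    have h_sq := hχ (cubicE ℝ i l k) (cubicE ℝ i l k)
    rw [cubicMul_cubicE_of_ne a h.symm, map_zero] at h_sq
    exact mul_self_eq_zero.mp h_sq.symm
  have h_all : ∀ i l k, χ (cubicE ℝ i l k) = 0 := by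
    intro i l k
    by_cases h : i = k
    · subst h
      have : Nontrivial (Fin m) := Fin.nontrivial_iff_two_le.mpr hm
      obtain ⟨j, hj⟩ := exists_ne i
      have h_sq := hχ (cubicE ℝ i l i) (cubicE ℝ i l i)
      have h_prod := hχ (cubicE ℝ i l j) (cubicE ℝ j l i)
      rw [cubicMul_cubicE] at h_sq h_prod
      rw [h_off i l j hj.symm, zero_mul] at h_prod
      exact mul_self_eq_zero.mp (h_sq.symm.trans h_prod)
    · exact h_off i l k h
  ext i j k
  simpa [cubicE_eq_single] using h_all i j k
end

section
/- Let F be a field, m ≥ 1, and a : I × I → I an associative binary operation on I = {1,…,m}. The linear map φ from the cubic matrix algebra 𝔠_a to the algebra of m×m square matrices over F defined by φ(X)(i,j) = Σ_{n∈I} X(i,n,j) is a surjective algebra homomorphism: φ is linear, surjective, and φ(X *_a Y) = φ(X)·φ(Y) (ordinary matrix product) for all cubic matrices X, Y. -/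
open Finset

/-- The map `φ(X)(i,j) = ∑ₙ X(i,n,j)` is a surjective algebra homomorphism from `𝔠_a` onto
the accompanying algebra of `m × m` square matrices. -/
theorem accompanying_hom_surjective {m : ℕ} (hm : 1 ≤ m) {F : Type*} [Field F]
    (a : Fin m → Fin m → Fin m)
    (ha : ∀ i j k, a (a i j) k = a i (a j k)) :
    let φ : CubicMatrix m F → Matrix (Fin m) (Fin m) F :=
      fun X => Matrix.of fun i j => ∑ n, X i n j
    Function.Surjective φ ∧
    (∀ X Y : CubicMatrix m F, φ (X + Y) = φ X + φ Y) ∧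
    (∀ (c : F) (X : CubicMatrix m F), φ (c • X) = c • φ X) ∧
    (∀ X Y : CubicMatrix m F, φ (cubicMul a X Y) = φ X * φ Y) := by
  refine ⟨fun M => ?_, fun X Y => ?_, fun c X => ?_, fun X Y => ?_⟩
  · refine ⟨fun i n j => if n = ⟨0, hm⟩ then M i j else 0, ?_⟩
    ext i j
    simp
  · ext i j
    simp [Finset.sum_add_distrib]
  · ext i j
    simp [Finset.mul_sum]
  · ext i r
    calc ∑ j, ∑ l, ∑ n, (if a l n = j then ∑ k, X i l k * Y k n r else 0)
        = ∑ l, ∑ n, ∑ k, X i l k * Y k n r := by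
          rw [Finset.sum_comm]
          refine Finset.sum_congr rfl fun l _ => ?_
          rw [Finset.sum_comm]
          simp
      _ = ∑ k, ∑ l, ∑ n, X i l k * Y k n r := by
          rw [Finset.sum_comm (s := univ) (t := univ) (f := fun k l => ∑ n, X i l k * Y k n r)]
          exact Finset.sum_congr rfl fun l _ => Finset.sum_comm
      _ = ∑ k, (∑ l, X i l k) * ∑ n, Y k n r := by
          simp_rw [Finset.sum_mul_sum]
end

section
/- Let F be a field, m ≥ 1, and a : I × I → I an associative binary operation on I = {1,…,m}. The multiplication *_a on cubic matrices is commutative (A *_a B = B *_a A for all A, B) if and only if m = 1. -/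
open Finset

/-- The multiplication `*_a` on cubic matrices is commutative iff `m = 1`. -/
theorem ACM_commutative_iff {m : ℕ} (hm : 1 ≤ m) {F : Type*} [Field F]
    (a : Fin m → Fin m → Fin m)
    (ha : ∀ i j k, a (a i j) k = a i (a j k)) :
    (∀ A B : CubicMatrix m F, cubicMul a A B = cubicMul a B A) ↔ m = 1 := by
  constructor
  · intro h
    by_contra hne
    let x : Fin m := ⟨0, by omega⟩
    let y : Fin m := ⟨1, by omega⟩
    have hyx : y ≠ x := by simp [x, y]
    have key := congrFun (congrFun (congrFun (h (cubicE F x x x) (cubicE F x x y)) x) (a x x)) y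
    have hleft : cubicMul a (cubicE F x x x) (cubicE F x x y) x (a x x) y = 1 := by
      unfold cubicMul
      rw [Finset.sum_eq_single x, Finset.sum_eq_single x, if_pos rfl, Finset.sum_eq_single x] <;>
        simp +contextual [cubicE]
    have hright : cubicMul a (cubicE F x x y) (cubicE F x x x) x (a x x) y = 0 := by
      simp [cubicMul, cubicE, hyx]
    rw [hleft, hright] at key
    exact one_ne_zero key
  · rintro rfl A B
    funext i j r
    simp [cubicMul, Subsingleton.elim i 0, Subsingleton.elim r 0, mul_comm]
end

section
/- Let m ≥ 1, I = {1,…,m}, and let a : I × I → I be the right-symmetric operation a(i,j) = j. For a cubic matrix A over ℝ, let 𝔹 be the m×m matrix 𝔹(i,k) = Σ_{j∈I} A(i,j,k). Then there exists a nonzero cubic matrix X with A *_a X = 0 if and only if det 𝔹 = 0. -/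
open Finset

/-- For the right-symmetric operation, the slice `B · j r` is multiplied by the accompanying
matrix of `A`. -/
theorem cubicMul_right_symmetric {m : ℕ} {F : Type*} [Field F] (A B : CubicMatrix m F)
    (i j r : Fin m) :
    cubicMul (fun _ j => j) A B i j r =
      ((Matrix.of fun i k => ∑ j, A i j k).mulVec fun k => B k j r) i := by
  simp only [cubicMul, Finset.sum_ite_eq', Finset.mem_univ, if_true, Matrix.mulVec, dotProduct,
    Matrix.of_apply, Finset.sum_mul]
  exact Finset.sum_comm

/-- For the right-symmetric operation `a(i,j) = j`, a cubic matrix `A` over `ℝ` is a left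
zero divisor iff the determinant of its accompanying matrix `𝔹(i,k) = ∑ⱼ A(i,j,k)` is zero. -/
theorem leftZeroDivisor_iff_det_eq_zero_rs {m : ℕ} (hm : 1 ≤ m)
    (A : CubicMatrix m ℝ) :
    (∃ X : CubicMatrix m ℝ, X ≠ 0 ∧ cubicMul (fun _ j => j) A X = 0) ↔
      (Matrix.of fun i k => ∑ j, A i j k).det = 0 := by
  rw [← Matrix.exists_mulVec_eq_zero_iff]
  constructor
  · rintro ⟨X, hX, h⟩
    obtain ⟨k, j, r, hk⟩ : ∃ k j r, X k j r ≠ 0 := by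
      by_contra! hzero
      exact hX (funext fun k => funext fun j => funext fun r => hzero k j r)
    refine ⟨fun k => X k j r, fun hv => hk (congrFun hv k), funext fun i => ?_⟩
    rw [← cubicMul_right_symmetric, h]
    rfl
  · rintro ⟨v, hv, h⟩
    refine ⟨fun k _ _ => v k, fun hX => hv (funext fun k => ?_), ?_⟩
    · exact congrFun (congrFun (congrFun hX k) ⟨0, hm⟩) ⟨0, hm⟩
    · funext i j r
      rw [cubicMul_right_symmetric]
      exact congrFun h i
end

section
/- Let m ≥ 1, I = {1,…,m}, and let a : I × I → I be the left-symmetric operation a(i,j) = i. For a cubic matrix A over ℝ, let 𝔹 be the m×m matrix 𝔹(i,k) = Σ_{j∈I} A(i,j,k). Then there exists a nonzero cubic matrix X with X *_a A = 0 if and only if det 𝔹 = 0. -/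
open Finset

/-- Left-symmetric multiplication acts on each row `X i j` by the accompanying matrix. -/
lemma cubicMul_left_eq_vecMul {m : ℕ} {F : Type*} [Field F] (X A : CubicMatrix m F)
    (i j : Fin m) :
    cubicMul (fun i _ => i) X A i j =
      Matrix.vecMul (X i j) (Matrix.of fun i k => ∑ j, A i j k) := by
  ext r
  simp only [cubicMul, Matrix.vecMul, dotProduct, Matrix.of_apply, Finset.mul_sum]
  rw [Finset.sum_eq_single j (fun l _ hl => by simp [hl]) (by simp)]
  simpa using Finset.sum_comm

/-- For the left-symmetric operation `a(i,j) = i`, a cubic matrix `A` over `ℝ` is a right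
zero divisor iff the determinant of its accompanying matrix `𝔹(i,k) = ∑ⱼ A(i,j,k)` is zero. -/
theorem rightZeroDivisor_iff_det_eq_zero_ls {m : ℕ} (hm : 1 ≤ m)
    (A : CubicMatrix m ℝ) :
    (∃ X : CubicMatrix m ℝ, X ≠ 0 ∧ cubicMul (fun i _ => i) X A = 0) ↔
      (Matrix.of fun i k => ∑ j, A i j k).det = 0 := by
  rw [← Matrix.exists_vecMul_eq_zero_iff]
  constructor
  · rintro ⟨X, hX, h⟩
    obtain ⟨i, hi⟩ := Function.ne_iff.mp hX
    obtain ⟨j, hj⟩ := Function.ne_iff.mp hi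
    exact ⟨X i j, hj, by rw [← cubicMul_left_eq_vecMul, h]; rfl⟩
  · rintro ⟨v, hv, h⟩
    refine ⟨fun _ _ => v, fun h0 => hv (congrFun (congrFun h0 ⟨0, hm⟩) ⟨0, hm⟩), ?_⟩
    funext i j
    rw [cubicMul_left_eq_vecMul, h]
    rfl
end

section
/- Let m ≥ 2, I = {1,…,m}, and let a : I × I → I be the left-symmetric operation a(i,j) = i. Then every cubic matrix A over ℝ is a left zero divisor in 𝔠_a: for every cubic matrix A there exists a nonzero cubic matrix X with A *_a X = 0. -/
open Finset

/-- For `m ≥ 2` and the left-symmetric operation `a(i,j) = i`, every cubic matrix over `ℝ`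
is a left zero divisor. -/
theorem every_matrix_leftZeroDivisor_ls {m : ℕ} (hm : 2 ≤ m)
    (A : CubicMatrix m ℝ) :
    ∃ X : CubicMatrix m ℝ, X ≠ 0 ∧ cubicMul (fun i _ => i) A X = 0 := by
  let p : Fin m := ⟨0, by omega⟩
  let q : Fin m := ⟨1, by omega⟩
  have hpq : p ≠ q := by simp [p, q]
  refine ⟨fun _ n _ => (if n = p then 1 else 0) - (if n = q then 1 else 0), ?_, ?_⟩
  · intro h
    have h1 := congrFun (congrFun (congrFun h p) p) p
    simp [hpq] at h1
  · funext i j r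
    refine Finset.sum_eq_zero fun l _ => ?_
    by_cases hl : l = j
    · simp only [hl, if_true]
      rw [Finset.sum_comm]
      simp [← Finset.mul_sum]
    · simp [hl]
end

section
/- Let m ≥ 2, I = {1,…,m}, and let a : I × I → I be the right-symmetric operation a(i,j) = j. Then every cubic matrix A over ℝ is a right zero divisor in 𝔠_a: for every cubic matrix A there exists a nonzero cubic matrix X with X *_a A = 0. -/
open Finset

/-- For `m ≥ 2` and the right-symmetric operation `a(i,j) = j`, every cubic matrix over `ℝ`
is a right zero divisor. -/
theorem every_matrix_rightZeroDivisor_rs {m : ℕ} (hm : 2 ≤ m)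
    (A : CubicMatrix m ℝ) :
    ∃ X : CubicMatrix m ℝ, X ≠ 0 ∧ cubicMul (fun _ j => j) X A = 0 := by
  let p : Fin m := ⟨0, by omega⟩
  let q : Fin m := ⟨1, by omega⟩
  have hpq : p ≠ q := by simp [p, q]
  refine ⟨fun _ l _ => (if l = p then 1 else 0) - (if l = q then 1 else 0), fun h => ?_, ?_⟩
  · simpa [hpq] using congrFun (congrFun (congrFun h p) p) p
  · funext i j r
    simp [cubicMul, ← Finset.mul_sum, ← Finset.sum_mul]
end

section
/- Let F be a field, m ≥ 1, I = {1,…,m}, and a : I × I → I an associative binary operation. Then the subspace 𝔍_a⁰ = {X : Σ_{n∈I} X(i,n,j) = 0 for all i,j ∈ I} is a two-sided ideal of 𝔠_a: if X ∈ 𝔍_a⁰ then for every cubic matrix A, both A *_a X ∈ 𝔍_a⁰ and X *_a A ∈ 𝔍_a⁰. -/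
open Finset

/-- Summing a product of cubic matrices over the middle index gives the matrix product of the
middle-index sums. -/
theorem sum_cubicMul {m : ℕ} {F : Type*} [Field F] (a : Fin m → Fin m → Fin m)
    (A B : CubicMatrix m F) (i r : Fin m) :
    ∑ j, cubicMul a A B i j r = ∑ k, (∑ l, A i l k) * ∑ n, B k n r := by
  have h : ∑ j, cubicMul a A B i j r = ∑ l, ∑ n, ∑ k, A i l k * B k n r := by
    unfold cubicMul
    rw [Finset.sum_comm]
    refine Finset.sum_congr rfl fun l _ => ?_
    rw [Finset.sum_comm]
    simp
  simp_rw [h, Finset.sum_mul_sum]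
  rw [Finset.sum_comm (s := Finset.univ (α := Fin m)) (f := fun k l => ∑ n, A i l k * B k n r)]
  exact Finset.sum_congr rfl fun l _ => Finset.sum_comm

/-- The subspace `𝔍_a⁰ = {X : ∀ i j, ∑ₙ X i n j = 0}` is a two-sided ideal of `𝔠_a`. -/
theorem kernel_ideal {m : ℕ} (hm : 1 ≤ m) {F : Type*} [Field F]
    (a : Fin m → Fin m → Fin m)
    (ha : ∀ i j k, a (a i j) k = a i (a j k))
    (X : CubicMatrix m F) (hX : ∀ i j, ∑ n, X i n j = 0) :
    ∀ A : CubicMatrix m F,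
      (∀ i j, ∑ n, cubicMul a A X i n j = 0) ∧
      (∀ i j, ∑ n, cubicMul a X A i n j = 0) := by
  intro A
  constructor <;> intro i j <;> simp [sum_cubicMul, hX]
end

section
/- Let F be a field, m ≥ 1, I = {1,…,m}, and a : I × I → I an associative binary operation. For i ∈ I, define i₀ = i and i_n = a(i_{n-1}, i_{n-1}) for n ≥ 1. Then for all i, j ∈ I and all n ≥ 0, the n-th plenary power of the basis cubic matrix E_{jij} in 𝔠_a satisfies E_{jij}^{[n]} = E_{j,i_n,j}. -/
open Finset

/-- Plenary powers: `A^[0] = A`, `A^[n+1] = A^[n] *_a A^[n]`. -/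
def plenaryPow {m : ℕ} {F : Type*} [Field F] (a : Fin m → Fin m → Fin m)
    (A : CubicMatrix m F) : ℕ → CubicMatrix m F
  | 0 => A
  | n + 1 => cubicMul a (plenaryPow a A n) (plenaryPow a A n)

/-- With `i₀ = i` and `iₙ = a(iₙ₋₁, iₙ₋₁)`, the plenary powers of the basis matrix `E j i j`
satisfy `(E j i j)^[n] = E j iₙ j`. -/
theorem plenaryPow_basis {m : ℕ} (hm : 1 ≤ m) {F : Type*} [Field F]
    (a : Fin m → Fin m → Fin m)
    (ha : ∀ i j k, a (a i j) k = a i (a j k))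
    (i j : Fin m) (n : ℕ) :
    plenaryPow a (cubicE F j i j) n = cubicE F j ((fun x => a x x)^[n] i) j := by
  induction n with
  | zero => rfl
  | succ n ih =>
    rw [plenaryPow, ih, cubicMul_cubicE, Function.iterate_succ_apply']
end

section
/- Let F be a field, m ≥ 1, I = {1,…,m}, and let a : I × I → I be an associative binary operation. Then the multiplication *_a on cubic matrices is associative: (A *_a B) *_a C = A *_a (B *_a C) for all cubic matrices A, B, C. -/
open Finset

theorem cubicMul_apply_eq_sum_mul {m : ℕ} {F : Type*} [Field F] (a : Fin m → Fin m → Fin m)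
    (A B : CubicMatrix m F) (i j r : Fin m) :
    cubicMul a A B i j r =
      ∑ l, ∑ n, ∑ k, (if a l n = j then 1 else 0) * (A i l k * B k n r) := by
  simp only [cubicMul, ← Finset.mul_sum]
  simp only [ite_mul, one_mul, zero_mul]

theorem cubicMul_cubicMul_left_apply {m : ℕ} {F : Type*} [Field F]
    (a : Fin m → Fin m → Fin m) (A B C : CubicMatrix m F) (i j r : Fin m) :
    cubicMul a (cubicMul a A B) C i j r =
      ∑ p, ∑ q, ∑ n, ∑ s, ∑ k,
        (if a (a p q) n = j then 1 else 0) * (A i p s * B s q k * C k n r) := by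
  calc
    _ = ∑ n, ∑ k, ∑ l, ∑ p, ∑ q, ∑ s, (if a p q = l then
          (if a l n = j then 1 else 0) * (A i p s * B s q k * C k n r) else 0) := by
      rw [cubicMul_apply_eq_sum_mul, Finset.sum_comm]
      refine Finset.sum_congr rfl fun n _ => ?_
      rw [Finset.sum_comm]
      refine Finset.sum_congr rfl fun k _ => Finset.sum_congr rfl fun l _ => ?_
      rw [cubicMul_apply_eq_sum_mul]
      simp only [Finset.sum_mul, Finset.mul_sum]
      refine Finset.sum_congr rfl fun p _ => Finset.sum_congr rfl fun q _ =>
        Finset.sum_congr rfl fun s _ => ?_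
      split_ifs <;> ring
    _ = ∑ n, ∑ k, ∑ p, ∑ q, ∑ s,
          (if a (a p q) n = j then 1 else 0) * (A i p s * B s q k * C k n r) := by
      refine Finset.sum_congr rfl fun n _ => Finset.sum_congr rfl fun k _ => ?_
      rw [Finset.sum_comm]
      refine Finset.sum_congr rfl fun p _ => ?_
      rw [Finset.sum_comm]
      refine Finset.sum_congr rfl fun q _ => ?_
      rw [Finset.sum_comm]
      refine Finset.sum_congr rfl fun s _ => ?_
      rw [Finset.sum_ite_eq, if_pos (Finset.mem_univ _)]
    _ = _ := by
      trans ∑ n, ∑ p, ∑ q, ∑ s, ∑ k,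
          (if a (a p q) n = j then 1 else 0) * (A i p s * B s q k * C k n r)
      · refine Finset.sum_congr rfl fun n _ => ?_
        rw [Finset.sum_comm]
        refine Finset.sum_congr rfl fun p _ => ?_
        rw [Finset.sum_comm]
        exact Finset.sum_congr rfl fun q _ => Finset.sum_comm
      · rw [Finset.sum_comm]
        exact Finset.sum_congr rfl fun p _ => Finset.sum_comm

theorem cubicMul_cubicMul_right_apply {m : ℕ} {F : Type*} [Field F]
    (a : Fin m → Fin m → Fin m) (A B C : CubicMatrix m F) (i j r : Fin m) :
    cubicMul a A (cubicMul a B C) i j r =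
      ∑ p, ∑ q, ∑ n, ∑ s, ∑ k,
        (if a p (a q n) = j then 1 else 0) * (A i p s * B s q k * C k n r) := by
  rw [cubicMul_apply_eq_sum_mul]
  refine Finset.sum_congr rfl fun p _ => ?_
  calc
    _ = ∑ s, ∑ l, ∑ q, ∑ n, ∑ k, (if a q n = l then
          (if a p l = j then 1 else 0) * (A i p s * B s q k * C k n r) else 0) := by
      rw [Finset.sum_comm]
      refine Finset.sum_congr rfl fun s _ => Finset.sum_congr rfl fun l _ => ?_
      rw [cubicMul_apply_eq_sum_mul]
      simp only [Finset.mul_sum]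
      refine Finset.sum_congr rfl fun q _ => Finset.sum_congr rfl fun n _ =>
        Finset.sum_congr rfl fun k _ => ?_
      split_ifs <;> ring
    _ = ∑ s, ∑ q, ∑ n, ∑ k,
          (if a p (a q n) = j then 1 else 0) * (A i p s * B s q k * C k n r) := by
      refine Finset.sum_congr rfl fun s _ => ?_
      rw [Finset.sum_comm]
      refine Finset.sum_congr rfl fun q _ => ?_
      rw [Finset.sum_comm]
      refine Finset.sum_congr rfl fun n _ => ?_
      rw [Finset.sum_comm]
      refine Finset.sum_congr rfl fun k _ => ?_
      rw [Finset.sum_ite_eq, if_pos (Finset.mem_univ _)]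
    _ = _ := by
      rw [Finset.sum_comm]
      exact Finset.sum_congr rfl fun q _ => Finset.sum_comm

/-- If `a` is associative then the multiplication `*_a` of cubic matrices is associative. -/
theorem cubicMul_assoc {m : ℕ} (hm : 1 ≤ m) {F : Type*} [Field F]
    (a : Fin m → Fin m → Fin m)
    (ha : ∀ i j k, a (a i j) k = a i (a j k))
    (A B C : CubicMatrix m F) :
    cubicMul a (cubicMul a A B) C = cubicMul a A (cubicMul a B C) := by
  funext i j r
  simp only [cubicMul_cubicMul_left_apply, cubicMul_cubicMul_right_apply, ha]
end
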